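/- arXiv:1601.03928 — 3 statements merged into one kernel-verified Lean document; each statement's English description precedes it below -/
import Mathlib

section
/- (Theorem 2, column part) Let A be an m×n binary matrix (n ≥ 1) and let π = α⁻¹(A) be the corresponding m-tuple in (Fin (2^n))^m. Then the matrix C = α(f_c(π)) is obtained from A by moving the last column to the first position: for all i and j, C i j = A i (j − 1), where j − 1 is taken cyclically in Fin n (so column 0 of C is column n−1 of A, and column j of C is column j−1 of A for j ≥ 1). -/
/-- The coding map `α` sending an `m`-tuple of numbers in `P_n = {0, …, 2^n − 1}`
to the `m × n` binary matrix whose `i`-th row is the `n`-digit binary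
representation of `p_i` (most significant digit first). -/
def alpha (m n : ℕ) (π : Fin m → Fin (2 ^ n)) : Matrix (Fin m) (Fin n) Bool :=
  fun i j => Nat.testBit (π i : ℕ) (n - 1 - (j : ℕ))

/-- The function `ξ(a) = (a % 2) · 2^(n−1) + a / 2`, viewed (for `n ≥ 1`) as a
map of `P_n = {0, …, 2^n − 1}`, modeled as `Fin (2^n)`, into itself. -/
def xiFin (n : ℕ) (hn : 1 ≤ n) (a : Fin (2 ^ n)) : Fin (2 ^ n) :=
  ⟨(a.val % 2) * 2 ^ (n - 1) + a.val / 2, by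
    have ha := a.isLt
    have h2 : 2 ^ n = 2 * 2 ^ (n - 1) := by
      conv_lhs => rw [show n = (n - 1) + 1 by omega]
      ring
    have h1 : a.val % 2 ≤ 1 := Nat.lt_succ_iff.mp (Nat.mod_lt _ (by norm_num))
    have h3 : a.val / 2 < 2 ^ (n - 1) := Nat.div_lt_of_lt_mul (by omega)
    have h4 := Nat.mul_le_mul_right (2 ^ (n - 1)) h1
    omega⟩

/-- The map `f_c` applies `ξ` componentwise:
`f_c (p_1, …, p_m) = (ξ p_1, …, ξ p_m)`. -/
def fc (m n : ℕ) (hn : 1 ≤ n) (π : Fin m → Fin (2 ^ n)) : Fin m → Fin (2 ^ n) :=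
  fun i => xiFin n hn (π i)

/-- The binary digits of `xiFin n hn a` in positions below `n - 1` are those of `a / 2`, and
the digit in position `n - 1` is the lowest digit of `a`. -/
theorem testBit_xiFin (n : ℕ) (hn : 1 ≤ n) (a : Fin (2 ^ n)) {k : ℕ} (hk : k < n) :
    (xiFin n hn a : ℕ).testBit k =
      if k = n - 1 then (a : ℕ).testBit 0 else (a : ℕ).testBit (k + 1) := by
  have hlt : (a : ℕ) / 2 < 2 ^ (n - 1) := by
    rw [Nat.div_lt_iff_lt_mul two_pos, ← pow_succ, Nat.sub_add_cancel hn]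
    exact a.isLt
  have hx : (xiFin n hn a : ℕ) = 2 ^ (n - 1) * ((a : ℕ) % 2) + (a : ℕ) / 2 := by
    simp only [xiFin, mul_comm]
  rw [hx, Nat.testBit_two_pow_mul_add _ hlt]
  split_ifs with h1 h2 h2
  · omega
  · rw [Nat.testBit_succ]
  · subst h2
    simp
  · omega

/-- Theorem 2 (column part): for `n ≥ 1`, if `A = α π`, then the matrix
`C = α (f_c π)` is obtained from `A` by moving the last column to the first
position: `C i j = A i (j−1)` with subtraction cyclic in `Fin n`. -/
theorem alpha_fc (m n : ℕ) (hn : 1 ≤ n) [NeZero n] (A : Matrix (Fin m) (Fin n) Bool)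
    (π : Fin m → Fin (2 ^ n)) (hπ : alpha m n π = A) :
    ∀ i j, alpha m n (fc m n hn π) i j = A i (j - 1) := by
  subst hπ
  intro i j
  have hj := j.isLt
  simp only [alpha, fc]
  rw [testBit_xiFin n hn (π i) (by omega)]
  have hval : ((j - 1 : Fin n) : ℕ) = if (j : ℕ) = 0 then n - 1 else (j : ℕ) - 1 := by
    rcases hn.eq_or_lt with rfl | h
    · simp
    · rw [Fin.val_sub, Fin.val_one', Nat.mod_eq_of_lt h]
      split_ifs with h0
      · rw [h0, add_zero, Nat.mod_eq_of_lt (by omega)]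
      · rw [show n - 1 + (j : ℕ) = (j : ℕ) - 1 + n by omega, Nat.add_mod_right,
          Nat.mod_eq_of_lt (by omega)]
  rw [hval]
  split_ifs <;> first | omega | (congr 1; omega)
end

section
/- (Proposition 2, column part) For every natural number n ≥ 1 and every m-tuple π in (Fin (2^n))^m, iterating the map f_c exactly n times returns π: f_c^[n](π) = π. -/
theorem xiFin_iterate_val (n : ℕ) (hn : 1 ≤ n) (a : Fin (2 ^ n)) (k : ℕ) (hk : k ≤ n) :
    ((xiFin n hn)^[k] a).val = (a.val % 2 ^ k) * 2 ^ (n - k) + a.val / 2 ^ k := by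
  induction k with
  | zero => simp [Nat.mod_one]
  | succ k ih =>
    obtain ⟨d, rfl⟩ : ∃ d, n = k + 1 + d := ⟨n - (k + 1), by omega⟩
    rw [Function.iterate_succ_apply']
    simp only [xiFin]
    rw [ih (by omega), Nat.mod_pow_succ, pow_succ 2 k, ← Nat.div_div_eq_div_mul,
      show k + 1 + d - k = d + 1 by omega, show k + 1 + d - (k + 1) = d by omega,
      show k + 1 + d - 1 = k + d by omega]
    generalize a.val % 2 ^ k = r
    generalize a.val / 2 ^ k = q
    have h : r * 2 ^ (d + 1) + q = 2 * (r * 2 ^ d) + q := by ring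
    rw [h, Nat.mul_add_mod, Nat.mul_add_div two_pos]
    ring

theorem xiFin_iterate_self (n : ℕ) (hn : 1 ≤ n) : (xiFin n hn)^[n] = id := by
  funext a
  apply Fin.ext
  rw [xiFin_iterate_val n hn a n le_rfl]
  simp [Nat.mod_eq_of_lt a.isLt, Nat.div_eq_of_lt a.isLt]

theorem fc_iterate_apply (m n : ℕ) (hn : 1 ≤ n) (π : Fin m → Fin (2 ^ n)) (k : ℕ) (i : Fin m) :
    (fc m n hn)^[k] π i = (xiFin n hn)^[k] (π i) := by
  induction k with
  | zero => rfl
  | succ k ih => rw [Function.iterate_succ_apply', Function.iterate_succ_apply', fc, ih]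

/-- Proposition 2 (column part): for `n ≥ 1`, iterating `f_c` exactly `n` times
is the identity. -/
theorem fc_iterate (m n : ℕ) (hn : 1 ≤ n) (π : Fin m → Fin (2 ^ n)) :
    (fc m n hn)^[n] π = π := by
  funext i
  rw [fc_iterate_apply, xiFin_iterate_self, id]
end

section
/- The number of equivalence classes of 3×3 binary matrices under the equivalence relation ρ (two matrices are equivalent iff one is obtained from the other by cyclic shifts of rows and columns) equals 64. -/
/-- Pairs `(k, l)` act on `m × n` binary matrices by cyclically shifting the rows by `k` and the
columns by `l`. -/
abbrev cyclicShift (m n : ℕ) [NeZero m] [NeZero n] :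
    AddAction (Fin m × Fin n) (Matrix (Fin m) (Fin n) Bool) where
  vadd g X := fun i j => X (i + g.1) (j + g.2)
  zero_vadd X := by
    funext i j
    exact congrArg₂ X (add_zero i) (add_zero j)
  add_vadd g h X := by
    funext i j
    exact congrArg₂ X (add_assoc i g.1 h.1).symm (add_assoc j g.2 h.2).symm

/-- By Burnside's lemma, the orbits of cyclic shifts are counted by fixed matrices. -/
theorem card_classes_mul (m n : ℕ) [NeZero m] [NeZero n] :
    Nat.card (Quot (fun X Y : Matrix (Fin m) (Fin n) Bool =>
      ∃ k : Fin m, ∃ l : Fin n, ∀ i j, Y i j = X (i + k) (j + l))) * (m * n) =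
    ∑ g : Fin m × Fin n, Fintype.card
      {X : Fin m → Fin n → Bool // ∀ i j, X (i + g.1) (j + g.2) = X i j} := by
  classical
  let := cyclicShift m n
  have burnside := AddAction.sum_card_fixedBy_eq_card_orbits_mul_card_addGroup
    (Fin m × Fin n) (Matrix (Fin m) (Fin n) Bool)
  have orbits : Nat.card (Quot (fun X Y : Matrix (Fin m) (Fin n) Bool =>
      ∃ k : Fin m, ∃ l : Fin n, ∀ i j, Y i j = X (i + k) (j + l))) =
      Nat.card (Quotient (AddAction.orbitRel (Fin m × Fin n)
        (Matrix (Fin m) (Fin n) Bool))) := by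
    refine Nat.card_congr (Quot.congrRight fun X Y => ?_)
    refine Iff.trans ?_ (Setoid.comm' (AddAction.orbitRel _ _))
    constructor
    · rintro ⟨k, l, h⟩
      exact ⟨(k, l), funext fun i => funext fun j => (h i j).symm⟩
    · rintro ⟨⟨k, l⟩, h⟩
      exact ⟨k, l, fun i j => (congrFun (congrFun h i) j).symm⟩
  rw [orbits, Nat.card_eq_fintype_card]
  simp only [Fintype.card_prod, Fintype.card_fin] at burnside
  rw [← burnside]
  refine Finset.sum_congr rfl fun g _ => Fintype.card_congr (Equiv.subtypeEquivRight fun X => ?_)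
  exact ⟨fun h i j => congrFun (congrFun h i) j, fun h => funext fun i => funext fun j => h i j⟩

/-- The number of equivalence classes of `3 × 3` binary matrices under cyclic
shifts of rows and columns is `64`. -/
theorem card_classes_three_three :
    Nat.card (Quot (fun X Y : Matrix (Fin 3) (Fin 3) Bool =>
      ∃ k : Fin 3, ∃ l : Fin 3, ∀ i j, Y i j = X (i + k) (j + l))) = 64 := by
  have fixed : ∑ g : Fin 3 × Fin 3, Fintype.card
      {X : Fin 3 → Fin 3 → Bool // ∀ i j, X (i + g.1) (j + g.2) = X i j} = 576 := by
    decide +kernel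
  have h := card_classes_mul 3 3
  rw [fixed] at h
  omega
end
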